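/- Let r ≥ 1, λ_1,…,λ_r > 0, μ_1,…,μ_r ∈ ℂ, θ = Im(2Σ_{j=1}^r(μ_j - 1/2)). Define R_ν(s) = B_{ν+1}(1-2s-iθ) + B_{ν+1}(1) - Σ_{j=1}^r (B_{ν+1}(λ_j(1-s)+conj(μ_j)) + B_{ν+1}(1-λ_j s-μ_j))/λ_j^ν with B_n the n-th Bernoulli polynomial; V_μ(s) = (-1)^μ Σ_{m=1}^{μ} (1/m!) Σ_{ν_1+⋯+ν_m=μ, ν_i≥1} ∏_{i=1}^m R_{ν_i}(s)/(ν_i(ν_i+1)); C_{μ,ℓ} by C_{1,ℓ} = (-1)^{ℓ-1}(ℓ-1)! and C_{μ+1,ℓ} = (-1)^{ℓ-1}(ℓ-1)! Σ_{m=μ}^{ℓ-1}(-1)^m C_{μ,m}/m!; A_{μ,ν}(s) = Σ_{k=0}^{ν-μ} binom(-μ, k) C_{μ+k,ν} (2s-1+iθ)^k; and Q_ν(s) = Σ_{μ=1}^{ν} V_μ(s) A_{μ,ν}(s). Then for every real c ≥ 1 there exists c' > 0 such that for all s ∈ ℂ and all integers ν with 1 ≤ ν ≤ |s| + c, one has |Q_ν(s)|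 ≤ (c'(|s|+1))^{2ν}/ν!. -/

import Mathlib

theorem aux_two_pow_le (n : ℕ) : 2 ^ n ≤ (n + 1).factorial := by
  induction n with
  | zero => simp
  | succ k ih =>
    rw [Nat.factorial_succ, pow_succ, mul_comm]
    exact Nat.mul_le_mul (by omega) ih

theorem aux_geom (n : ℕ) : ∑ k ∈ Finset.range n, (2:ℝ) ^ k ≤ 2 ^ n := by
  rw [geom_sum_eq (by norm_num)]
  norm_num

theorem aux_bern (n : ℕ) : |((bernoulli n : ℚ) : ℝ)| ≤ n.factorial := by
  induction n using Nat.strong_induction_on with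
  | _ n ih =>
    rcases Nat.eq_zero_or_pos n with h0 | hn
    · subst h0; simp
    have h := sum_bernoulli (n + 1)
    rw [if_neg (by omega), Finset.sum_range_succ] at h
    have h' : ∑ k ∈ Finset.range n, ((n + 1).choose k : ℝ) * ((bernoulli k : ℚ) : ℝ)
        + ((n:ℝ) + 1) * ((bernoulli n : ℚ) : ℝ) = 0 := by
      have := congrArg (fun q : ℚ => (q : ℝ)) h
      simpa using this
    have hle : |∑ k ∈ Finset.range n, ((n + 1).choose k : ℝ) * ((bernoulli k : ℚ) : ℝ)|
        ≤ (n + 1).factorial := by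
      calc _ ≤ ∑ k ∈ Finset.range n, |((n + 1).choose k : ℝ) * ((bernoulli k : ℚ) : ℝ)| :=
            Finset.abs_sum_le_sum_abs _ _
        _ ≤ ∑ k ∈ Finset.range n, ((n + 1).factorial / 2 ^ n : ℝ) * 2 ^ k := by
            apply Finset.sum_le_sum
            intro k hk
            have hk := Finset.mem_range.1 hk
            rw [abs_mul, Nat.abs_cast]
            have h1 := Nat.choose_mul_factorial_mul_factorial (n := n + 1) (k := k) (by omega)
            have h2 : 2 ^ (n - k) ≤ (n + 1 - k).factorial := by
              have := aux_two_pow_le (n - k)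
              rwa [show n - k + 1 = n + 1 - k by omega] at this
            have h3 : (n + 1).choose k * k.factorial * 2 ^ (n - k) ≤ (n + 1).factorial := by
              rw [← h1]; exact Nat.mul_le_mul_left _ h2
            have h4 : ((n + 1).choose k * k.factorial * 2 ^ (n - k) : ℝ) ≤ (n + 1).factorial := by
              exact_mod_cast h3
            have h5 : (2:ℝ) ^ n = 2 ^ (n - k) * 2 ^ k := by
              rw [← pow_add]; congr 1; omega
            calc _ ≤ ((n + 1).choose k : ℝ) * k.factorial :=
                  mul_le_mul_of_nonneg_left (ih k hk) (by positivity)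
              _ ≤ _ := by
                  rw [h5, div_mul_eq_mul_div, le_div_iff₀ (by positivity)]
                  nlinarith [pow_pos (show (0:ℝ) < 2 by norm_num) k]
        _ = ((n + 1).factorial / 2 ^ n : ℝ) * ∑ k ∈ Finset.range n, 2 ^ k := by
            rw [Finset.mul_sum]
        _ ≤ ((n + 1).factorial / 2 ^ n : ℝ) * 2 ^ n :=
            mul_le_mul_of_nonneg_left (aux_geom n) (by positivity)
        _ = _ := by field_simp
    have h6 : ((n:ℝ) + 1) * |((bernoulli n : ℚ) : ℝ)| ≤ (n + 1).factorial := by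
      have : ((n:ℝ) + 1) * ((bernoulli n : ℚ) : ℝ) =
        - ∑ k ∈ Finset.range n, ((n + 1).choose k : ℝ) * ((bernoulli k : ℚ) : ℝ) := by linarith
      rw [← abs_of_pos (show (0:ℝ) < (n:ℝ) + 1 by positivity), ← abs_mul, this, abs_neg]
      exact hle
    rw [Nat.factorial_succ] at h6
    push_cast at h6
    exact le_of_mul_le_mul_left h6 (by positivity)

theorem aux_bpoly (n : ℕ) (x : ℂ) :
    ‖Polynomial.aeval x (Polynomial.bernoulli n)‖ ≤ (n + ‖x‖) ^ n := by
  rw [Polynomial.bernoulli, map_sum, add_pow]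
  refine (norm_sum_le _ _).trans (Finset.sum_le_sum ?_)
  intro k hk
  have hk := Finset.mem_range.1 hk
  rw [Polynomial.aeval_monomial, norm_mul, norm_pow]
  have h1 : ‖(algebraMap ℚ ℂ) (bernoulli k * (n.choose k : ℚ))‖
      = |((bernoulli k : ℚ) : ℝ)| * (n.choose k) := by
    rw [map_mul, norm_mul]
    rw [eq_ratCast, map_natCast, Complex.norm_natCast, ← Complex.ofReal_ratCast,
      Complex.norm_real, Real.norm_eq_abs]
  rw [h1]
  have h2 : (k.factorial : ℝ) ≤ (n:ℝ) ^ k := by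
    have : k.factorial ≤ n ^ k := (Nat.factorial_le_pow k).trans (Nat.pow_le_pow_left (by omega) k)
    exact_mod_cast this
  have h3 := (aux_bern k).trans h2
  calc _ ≤ (n:ℝ) ^ k * (n.choose k) * ‖x‖ ^ (n - k) := by gcongr
    _ = _ := by ring

theorem aux_fact (a b : ℕ) (X : ℝ) (hab : a ≤ b) (hX : (b:ℝ) ≤ X) :
    (b.factorial : ℝ) ≤ a.factorial * X ^ (b - a) := by
  induction b, hab using Nat.le_induction with
  | base => simp
  | succ b hb ih =>
    push_cast at hX
    have h0 : (0:ℝ) ≤ b := by positivity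
    rw [Nat.factorial_succ, Nat.succ_sub hb, pow_succ]
    push_cast
    have := ih (by linarith)
    have hX0 : 0 ≤ X := by linarith
    calc _ ≤ X * (a.factorial * X ^ (b - a)) := by gcongr
      _ = _ := by ring

theorem aux_card (k n : ℕ) : (Finset.Nat.antidiagonalTuple k n).card ≤ 2 ^ (n + k) := by
  induction k generalizing n with
  | zero =>
    cases n with
    | zero => simp
    | succ n => simp
  | succ k ih =>
    have hsub : Finset.Nat.antidiagonalTuple (k + 1) n ⊆
        (Finset.range (n + 1)).biUnion (fun j => (Finset.Nat.antidiagonalTuple k j).image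
          (fun x => (Fin.cons (n - j) x : Fin (k + 1) → ℕ))) := by
      intro x hx
      rw [Finset.Nat.mem_antidiagonalTuple, Fin.sum_univ_succ] at hx
      rw [Finset.mem_biUnion]
      refine ⟨∑ i : Fin k, x i.succ, Finset.mem_range.2 (by omega), ?_⟩
      rw [Finset.mem_image]
      refine ⟨Fin.tail x, ?_, ?_⟩
      · rw [Finset.Nat.mem_antidiagonalTuple]; rfl
      · rw [show n - ∑ i : Fin k, x i.succ = x 0 by omega, Fin.cons_self_tail]
    refine (Finset.card_le_card hsub).trans (Finset.card_biUnion_le.trans ?_)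
    calc _ ≤ ∑ j ∈ Finset.range (n + 1), 2 ^ j * 2 ^ k := by
          apply Finset.sum_le_sum
          intro j _
          rw [← pow_add]
          exact Finset.card_image_le.trans (ih j)
      _ ≤ 2 ^ (n + 1) * 2 ^ k := by
          rw [← Finset.sum_mul]
          apply Nat.mul_le_mul_right
          exact_mod_cast aux_geom (n + 1)
      _ = _ := by rw [← pow_add]; congr 1; omega

theorem aux_C (C : ℕ → ℕ → ℂ)
    (hC1 : ∀ ℓ : ℕ, 1 ≤ ℓ → C 1 ℓ = (-1 : ℂ) ^ (ℓ - 1) * (Nat.factorial (ℓ - 1)))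
    (hCrec : ∀ μ ℓ : ℕ, 1 ≤ μ → μ + 1 ≤ ℓ →
      C (μ + 1) ℓ = (-1 : ℂ) ^ (ℓ - 1) * (Nat.factorial (ℓ - 1)) *
        ∑ m ∈ Finset.Icc μ (ℓ - 1), (-1 : ℂ) ^ m * C μ m / (Nat.factorial m))
    (μ ℓ : ℕ) (h1 : 1 ≤ μ) (h2 : μ ≤ ℓ) :
    ‖C μ ℓ‖ ≤ 2 ^ ℓ * ℓ.factorial / μ.factorial := by
  induction μ, h1 using Nat.le_induction generalizing ℓ with
  | base =>
    rw [hC1 ℓ h2]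
    simp only [norm_mul, norm_pow, norm_neg, norm_one, one_pow, one_mul, Nat.factorial_one,
      Nat.cast_one, div_one, Complex.norm_natCast]
    have : ((ℓ - 1).factorial : ℝ) ≤ ℓ.factorial := by
      exact_mod_cast Nat.factorial_le (by omega)
    have h3 : (1:ℝ) ≤ 2 ^ ℓ := one_le_pow₀ (by norm_num)
    nlinarith [show (0:ℝ) ≤ ℓ.factorial by positivity]
  | succ μ hμ ih =>
    rw [hCrec μ ℓ hμ h2]
    simp only [norm_mul, norm_pow, norm_neg, norm_one, one_pow, one_mul, Complex.norm_natCast]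
    have hs : ‖∑ m ∈ Finset.Icc μ (ℓ - 1), (-1 : ℂ) ^ m * C μ m / (Nat.factorial m)‖
        ≤ 2 ^ ℓ / μ.factorial := by
      calc _ ≤ ∑ m ∈ Finset.Icc μ (ℓ - 1), (2:ℝ) ^ m / μ.factorial := by
            refine (norm_sum_le _ _).trans (Finset.sum_le_sum ?_)
            intro m hm
            have hm := Finset.mem_Icc.1 hm
            simp only [norm_mul, norm_div, norm_pow, norm_neg, norm_one, one_pow, one_mul,
              Complex.norm_natCast]
            rw [div_le_iff₀ (by positivity)]
            calc _ ≤ _ := ih m hm.1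
              _ = _ := by ring
        _ ≤ ∑ m ∈ Finset.range ℓ, (2:ℝ) ^ m / μ.factorial := by
            apply Finset.sum_le_sum_of_subset_of_nonneg
            · intro m hm
              have hm := Finset.mem_Icc.1 hm
              exact Finset.mem_range.2 (by omega)
            · intros; positivity
        _ = (∑ m ∈ Finset.range ℓ, (2:ℝ) ^ m) / μ.factorial := by rw [Finset.sum_div]
        _ ≤ _ := by gcongr; exact aux_geom ℓ
    obtain ⟨l, rfl⟩ : ∃ l, ℓ = l + 1 := ⟨ℓ - 1, by omega⟩
    rw [Nat.add_sub_cancel] at *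
    calc _ ≤ (l.factorial : ℝ) * (2 ^ (l + 1) / μ.factorial) := by gcongr
      _ ≤ _ := by
        rw [mul_div_assoc', div_le_div_iff₀ (by positivity) (by positivity),
          Nat.factorial_succ, Nat.factorial_succ]
        push_cast
        have : (μ:ℝ) + 1 ≤ l + 1 := by exact_mod_cast h2
        calc _ = (l.factorial * 2 ^ (l+1) * μ.factorial : ℝ) * (μ + 1) := by ring
          _ ≤ (l.factorial * 2 ^ (l+1) * μ.factorial : ℝ) * (l + 1) := by gcongr
          _ = _ := by ring

theorem aux_binom (μ k : ℕ) (hμ : 1 ≤ μ) :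
    ‖(∏ i ∈ Finset.range k, (-(μ : ℂ) - i)) / (Nat.factorial k)‖ ≤ 2 ^ (μ + k) := by
  rw [norm_div, norm_prod, Complex.norm_natCast]
  have h1 : ∏ i ∈ Finset.range k, ‖(-(μ : ℂ) - i)‖ = (μ.ascFactorial k : ℝ) := by
    rw [Nat.ascFactorial_eq_prod_range]
    push_cast
    apply Finset.prod_congr rfl
    intro i _
    rw [show (-(μ : ℂ) - i) = -((μ + i : ℕ) : ℂ) by push_cast; ring, norm_neg,
      Complex.norm_natCast]
    push_cast; rfl
  rw [h1, div_le_iff₀ (by positivity)]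
  obtain ⟨n, rfl⟩ : ∃ n, μ = n + 1 := ⟨μ - 1, by omega⟩
  rw [Nat.ascFactorial_eq_factorial_mul_choose]
  have h2 : (n + k).choose k ≤ 2 ^ (n + 1 + k) :=
    (Nat.choose_le_two_pow _ _).trans (Nat.pow_le_pow_right (by norm_num) (by omega))
  have h3 : ((n + k).choose k : ℝ) ≤ 2 ^ (n + 1 + k) := by exact_mod_cast h2
  push_cast
  rw [mul_comm]
  gcongr

theorem aux_V (T K c : ℝ) (hT : 1 ≤ T) (hK : 1 ≤ K) (hc : 1 ≤ c) (μ : ℕ) (h1 : 1 ≤ μ)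
    (hμ : (μ:ℝ) ≤ c * T) (R : ℕ → ℂ)
    (hR : ∀ n, 1 ≤ n → n ≤ μ → ‖R n‖ ≤ T * (K * T) ^ n) :
    ‖(-1 : ℂ) ^ μ * ∑ m ∈ Finset.Icc 1 μ, (1 / (Nat.factorial m : ℂ)) *
        ∑ ν ∈ (Finset.Nat.antidiagonalTuple m μ).filter (fun ν => ∀ i, 1 ≤ ν i),
          ∏ i, R (ν i) / (((ν i : ℕ) : ℂ) * (((ν i : ℕ) : ℂ) + 1))‖
      ≤ (8 * c * K * T ^ 2) ^ μ / μ.factorial := by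
  have hT0 : 0 < T := by linarith
  have hK0 : 0 < K := by linarith
  have hc0 : 0 < c := by linarith
  rw [norm_mul, norm_pow, norm_neg, norm_one, one_pow, one_mul]
  have key : ∀ m ∈ Finset.Icc 1 μ, ‖(1 / (Nat.factorial m : ℂ)) *
        ∑ ν ∈ (Finset.Nat.antidiagonalTuple m μ).filter (fun ν => ∀ i, 1 ≤ ν i),
          ∏ i, R (ν i) / (((ν i : ℕ) : ℂ) * (((ν i : ℕ) : ℂ) + 1))‖
      ≤ (4 * c * K * T ^ 2) ^ μ / μ.factorial := by
    intro m hm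
    have hm := Finset.mem_Icc.1 hm
    have hin : ‖∑ ν ∈ (Finset.Nat.antidiagonalTuple m μ).filter (fun ν => ∀ i, 1 ≤ ν i),
          ∏ i, R (ν i) / (((ν i : ℕ) : ℂ) * (((ν i : ℕ) : ℂ) + 1))‖
          ≤ 4 ^ μ * (T ^ m * (K * T) ^ μ) := by
      refine (norm_sum_le_of_le (f := _) _ (n := fun _ => T ^ m * (K * T) ^ μ) ?_).trans ?_
      · intro x hx
        obtain ⟨hx1, hx2⟩ := Finset.mem_filter.1 hx
        rw [Finset.Nat.mem_antidiagonalTuple] at hx1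
        rw [norm_prod]
        calc _ ≤ ∏ i : Fin m, T * (K * T) ^ (x i) := by
              apply Finset.prod_le_prod
              · intros; positivity
              · intro i _
                have hle : x i ≤ μ := by
                  rw [← hx1]
                  exact Finset.single_le_sum (f := x) (fun _ _ => Nat.zero_le _)
                    (Finset.mem_univ i)
                refine le_trans ?_ (hR (x i) (hx2 i) hle)
                rw [norm_div]
                apply div_le_self (norm_nonneg _)
                have : ((x i : ℂ) * ((x i : ℂ) + 1)) = ((x i * (x i + 1) : ℕ) : ℂ) := by
                  push_cast; rfl
                rw [this, Complex.norm_natCast]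
                have := hx2 i
                exact_mod_cast Nat.mul_pos (by omega) (by omega)
          _ = _ := by
              rw [Finset.prod_mul_distrib, Finset.prod_pow_eq_pow_sum, hx1]
              simp
      · rw [Finset.sum_const, nsmul_eq_mul]
        gcongr
        have h2 : 2 ^ (μ + m) ≤ 4 ^ μ := by
          rw [show 4 = 2 ^ 2 by norm_num, ← pow_mul]
          exact Nat.pow_le_pow_right (by norm_num) (by omega)
        have := ((Finset.card_filter_le _ (fun ν : Fin m → ℕ => ∀ i, 1 ≤ ν i)).trans
          (aux_card m μ)).trans h2
        exact_mod_cast this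
    have hf := aux_fact m μ (c * T) hm.2 hμ
    rw [norm_mul, norm_div, norm_one, Complex.norm_natCast]
    have hTm : T ^ m ≤ (c * T) ^ m := by
      gcongr
      nlinarith
    have hsplit : (c * T) ^ μ = (c * T) ^ m * (c * T) ^ (μ - m) := by
      rw [← pow_add]; congr 1; omega
    have hq : T ^ m / m.factorial ≤ (c * T) ^ μ / μ.factorial := by
      rw [div_le_div_iff₀ (by positivity) (by positivity), hsplit]
      calc _ ≤ (c * T) ^ m * (m.factorial * (c * T) ^ (μ - m)) := by gcongr
        _ = _ := by ring
    calc _ ≤ 1 / (m.factorial : ℝ) * (4 ^ μ * (T ^ m * (K * T) ^ μ)) := by gcongr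
      _ = (T ^ m / m.factorial) * (4 ^ μ * (K * T) ^ μ) := by ring
      _ ≤ ((c * T) ^ μ / μ.factorial) * (4 ^ μ * (K * T) ^ μ) := by gcongr
      _ = _ := by
        rw [show 4 * c * K * T ^ 2 = (c * T) * (4 * (K * T)) by ring, mul_pow (c * T), mul_pow 4]
        ring
  refine (norm_sum_le_of_le _ key).trans ?_
  rw [Finset.sum_const, nsmul_eq_mul, Nat.card_Icc]
  have h2 : ((μ + 1 - 1 : ℕ) : ℝ) ≤ 2 ^ μ := by
    exact_mod_cast (show μ + 1 - 1 ≤ 2 ^ μ from (Nat.lt_two_pow_self).le)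
  calc _ ≤ 2 ^ μ * ((4 * c * K * T ^ 2) ^ μ / μ.factorial) := by gcongr
    _ = _ := by
      rw [show 8 * c * K * T ^ 2 = 2 * (4 * c * K * T ^ 2) by ring, mul_pow 2]; ring

theorem aux_Q (T D M c : ℝ) (hT : 1 ≤ T) (hD : 1 ≤ D) (hM : 1 ≤ M) (hc : 1 ≤ c) (ν : ℕ)
    (hν : (ν:ℝ) ≤ c * T) (V : ℕ → ℂ) (z : ℂ) (hz : ‖z‖ ≤ M * T)
    (hV : ∀ μ, 1 ≤ μ → μ ≤ ν → ‖V μ‖ ≤ (D * T ^ 2) ^ μ / μ.factorial)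
    (C : ℕ → ℕ → ℂ)
    (hC : ∀ μ ℓ : ℕ, 1 ≤ μ → μ ≤ ℓ → ‖C μ ℓ‖ ≤ 2 ^ ℓ * ℓ.factorial / μ.factorial) :
    ‖∑ μ ∈ Finset.Icc 1 ν, V μ * ∑ k ∈ Finset.range (ν - μ + 1),
        (∏ i ∈ Finset.range k, (-(μ : ℂ) - i)) / (Nat.factorial k) * C (μ + k) ν * z ^ k‖
    ≤ (4 * (D + M + c) * T) ^ (2 * ν) / ν.factorial := by
  have hT0 : 0 < T := by linarith
  set G := D + M + c with hG
  have hGT : 1 ≤ G * T := by nlinarith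
  have hG0 : 0 < G := by linarith
  have h2ν : (ν : ℝ) ≤ 2 ^ ν := by
    exact_mod_cast (show ν ≤ 2 ^ ν from (Nat.lt_two_pow_self).le)
  have key : ∀ μ ∈ Finset.Icc 1 ν, ∀ k ∈ Finset.range (ν - μ + 1),
      ‖V μ * ((∏ i ∈ Finset.range k, (-(μ : ℂ) - i)) / (Nat.factorial k) * C (μ + k) ν * z ^ k)‖
      ≤ 4 ^ ν * (G * T) ^ (2 * ν) / ν.factorial := by
    intro μ hμ k hk
    have hμ := Finset.mem_Icc.1 hμ
    have hk := Finset.mem_range.1 hk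
    have hb : ‖(∏ i ∈ Finset.range k, (-(μ : ℂ) - i)) / (Nat.factorial k)‖ ≤ 2 ^ ν :=
      (aux_binom μ k hμ.1).trans (pow_le_pow_right₀ (by norm_num) (by omega))
    have hGc : c * T ≤ G * T := by gcongr; linarith
    have hf1 := aux_fact μ ν (G * T) hμ.2 (hν.trans hGc)
    have hf2 := aux_fact (μ + k) ν (G * T) (by omega) (hν.trans hGc)
    have hCb := hC (μ + k) ν (by omega) (by omega)
    have hVb := hV μ hμ.1 hμ.2
    have hzk : ‖z‖ ^ k ≤ (G * T) ^ k := by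
      gcongr
      refine hz.trans ?_
      gcongr; linarith
    have hVb2 : ‖V μ‖ ≤ (G * T) ^ (2 * μ) / μ.factorial := by
      refine hVb.trans ?_
      rw [pow_mul]
      gcongr
      rw [mul_pow]
      gcongr
      nlinarith
    rw [norm_mul, norm_mul, norm_mul, norm_pow]
    have hsp : (G * T) ^ (2 * ν) =
        (G * T) ^ (2 * μ) * (G * T) ^ k * (G * T) ^ (ν - μ) * (G * T) ^ (ν - (μ + k)) := by
      rw [← pow_add, ← pow_add, ← pow_add]; congr 1; omega
    calc _ ≤ (G * T) ^ (2 * μ) / μ.factorial *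
          (2 ^ ν * (2 ^ ν * ν.factorial / (μ + k).factorial) * (G * T) ^ k) := by gcongr
      _ = 4 ^ ν * ((G * T) ^ (2 * μ) * (G * T) ^ k * ν.factorial)
          / (μ.factorial * (μ + k).factorial) := by
          rw [show (4:ℝ) = 2 * 2 by norm_num, mul_pow (2:ℝ) 2]
          generalize (2 : ℝ) ^ ν = p
          ring
      _ ≤ _ := by
          rw [div_le_div_iff₀ (by positivity) (by positivity), hsp]
          calc _ = 4 ^ ν * ((G * T) ^ (2 * μ) * (G * T) ^ k) * (ν.factorial * ν.factorial) := by
                ring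
            _ ≤ 4 ^ ν * ((G * T) ^ (2 * μ) * (G * T) ^ k) *
                ((μ.factorial * (G * T) ^ (ν - μ)) *
                  ((μ + k).factorial * (G * T) ^ (ν - (μ + k)))) := by gcongr
            _ = _ := by ring
  have key2 : ∀ μ ∈ Finset.Icc 1 ν, ‖V μ * ∑ k ∈ Finset.range (ν - μ + 1),
        (∏ i ∈ Finset.range k, (-(μ : ℂ) - i)) / (Nat.factorial k) * C (μ + k) ν * z ^ k‖
      ≤ 2 ^ ν * (4 ^ ν * (G * T) ^ (2 * ν) / ν.factorial) := by
    intro μ hμ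
    rw [Finset.mul_sum]
    refine (norm_sum_le_of_le _ (key μ hμ)).trans ?_
    have hμ := Finset.mem_Icc.1 hμ
    rw [Finset.sum_const, nsmul_eq_mul, Finset.card_range]
    gcongr
    refine le_trans ?_ h2ν
    exact_mod_cast (show ν - μ + 1 ≤ ν by omega)
  refine (norm_sum_le_of_le _ key2).trans ?_
  rw [Finset.sum_const, nsmul_eq_mul, Nat.card_Icc, Nat.add_sub_cancel]
  calc _ ≤ 2 ^ ν * (2 ^ ν * (4 ^ ν * (G * T) ^ (2 * ν) / ν.factorial)) := by gcongr
    _ = _ := by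
      rw [show 4 * G * T = 4 * (G * T) by ring, mul_pow 4, pow_mul 4,
        show (4:ℝ) ^ 2 = 2 * 2 * 4 by norm_num, mul_pow (2 * 2 : ℝ), mul_pow (2 : ℝ) 2]
      generalize (4 : ℝ) ^ ν = q
      generalize (2 : ℝ) ^ ν = p
      ring

theorem aux_R (r : ℕ) (lam : Fin r → ℝ) (hlam : ∀ j, 0 < lam j)
    (a b : ℂ) (x y : Fin r → ℂ) (K T L : ℝ) (hK : 1 ≤ K) (hT : 1 ≤ T) (hL : 1 ≤ L)
    (hLl : ∀ j, 1 / lam j ≤ L) (n : ℕ) (hn : 1 ≤ n)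
    (ha : (n + 1 : ℕ) + ‖a‖ ≤ K * T) (hb : (n + 1 : ℕ) + ‖b‖ ≤ K * T)
    (hx : ∀ j, (n + 1 : ℕ) + ‖x j‖ ≤ K * T) (hy : ∀ j, (n + 1 : ℕ) + ‖y j‖ ≤ K * T) :
    ‖Polynomial.aeval a (Polynomial.bernoulli (n + 1)) +
        Polynomial.aeval b (Polynomial.bernoulli (n + 1)) -
        ∑ j, (Polynomial.aeval (x j) (Polynomial.bernoulli (n + 1)) +
            Polynomial.aeval (y j) (Polynomial.bernoulli (n + 1))) / (lam j : ℂ) ^ n‖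
      ≤ T * (((2 + 2 * r) * K * K * L) * T) ^ n := by
  have hB : ∀ w : ℂ, (n + 1 : ℕ) + ‖w‖ ≤ K * T →
      ‖Polynomial.aeval w (Polynomial.bernoulli (n + 1))‖ ≤ (K * T) ^ (n + 1) := by
    intro w hw
    refine (aux_bpoly (n + 1) w).trans ?_
    gcongr
  have hLn : 1 ≤ L ^ n := one_le_pow₀ hL
  have hP : 0 ≤ (K * T) ^ (n + 1) := by positivity
  have hj : ∀ j ∈ Finset.univ, ‖(Polynomial.aeval (x j) (Polynomial.bernoulli (n + 1)) +
            Polynomial.aeval (y j) (Polynomial.bernoulli (n + 1))) / (lam j : ℂ) ^ n‖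
        ≤ 2 * (K * T) ^ (n + 1) * L ^ n := by
    intro j _
    rw [div_eq_mul_one_div, norm_mul, norm_div, norm_one, norm_pow, Complex.norm_real,
      Real.norm_of_nonneg (hlam j).le, ← one_div_pow]
    have h1 := norm_add_le_of_le (hB _ (hx j)) (hB _ (hy j))
    have h2 := hLl j
    have h3 := hlam j
    rw [← two_mul] at h1
    gcongr
  have hs := norm_sum_le_of_le _ hj
  rw [Finset.sum_const, nsmul_eq_mul, Finset.card_univ, Fintype.card_fin] at hs
  have htot := norm_sub_le_of_le (norm_add_le_of_le (hB a ha) (hB b hb)) hs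
  refine htot.trans ?_
  have hE : (1:ℝ) ≤ (2 + 2 * r) * K := by
    have : (0:ℝ) ≤ r := by positivity
    nlinarith
  have hE2 : (2 + 2 * (r:ℝ)) * K ≤ ((2 + 2 * r) * K) ^ n := le_self_pow₀ hE (by omega)
  calc _ ≤ (2 + 2 * (r:ℝ)) * ((K * T) ^ (n + 1) * L ^ n) := by nlinarith
    _ = ((2 + 2 * (r:ℝ)) * K) * (T * (K * T * L) ^ n) := by
        rw [pow_succ, mul_pow (K * T)]; ring
    _ ≤ ((2 + 2 * (r:ℝ)) * K) ^ n * (T * (K * T * L) ^ n) := by gcongr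
    _ = _ := by
        rw [show (2 + 2 * (r:ℝ)) * K * K * L * T = ((2 + 2 * (r:ℝ)) * K) * (K * T * L) by ring,
          mul_pow ((2 + 2 * (r:ℝ)) * K)]
        ring

set_option maxHeartbeats 2000000 in

/-- Lemma 3.18: the bound `|Q_ν(s)| ≤ (c'(|s|+1))^{2ν}/ν!` for the polynomials `Q_ν(s)` of
the transformation formula, via the explicit formula `Q_ν = Σ_{μ=1}^ν V_μ A_{μ,ν}`. -/
theorem stmt_18
    (r : ℕ) (hr : 1 ≤ r) (lam : Fin r → ℝ) (hlam : ∀ j, 0 < lam j)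
    (mu : Fin r → ℂ) (θ : ℝ) (hθ : θ = (2 * ∑ j, (mu j - 1 / 2)).im)
    (R : ℕ → ℂ → ℂ)
    (hR : ∀ (ν : ℕ) (s : ℂ), R ν s =
      Polynomial.aeval (1 - 2 * s - (θ : ℂ) * Complex.I) (Polynomial.bernoulli (ν + 1)) +
        Polynomial.aeval (1 : ℂ) (Polynomial.bernoulli (ν + 1)) -
        ∑ j, (Polynomial.aeval ((lam j : ℂ) * (1 - s) + (starRingEnd ℂ) (mu j))
              (Polynomial.bernoulli (ν + 1)) +
            Polynomial.aeval (1 - (lam j : ℂ) * s - mu j) (Polynomial.bernoulli (ν + 1))) /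
          (lam j : ℂ) ^ ν)
    (V : ℕ → ℂ → ℂ)
    (hV : ∀ (μ : ℕ) (s : ℂ), 1 ≤ μ → V μ s =
      (-1 : ℂ) ^ μ * ∑ m ∈ Finset.Icc 1 μ, (1 / (Nat.factorial m : ℂ)) *
        ∑ ν ∈ (Finset.Nat.antidiagonalTuple m μ).filter (fun ν => ∀ i, 1 ≤ ν i),
          ∏ i, R (ν i) s / (((ν i : ℕ) : ℂ) * (((ν i : ℕ) : ℂ) + 1)))
    (C : ℕ → ℕ → ℂ)
    (hC1 : ∀ ℓ : ℕ, 1 ≤ ℓ → C 1 ℓ = (-1 : ℂ) ^ (ℓ - 1) * (Nat.factorial (ℓ - 1)))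
    (hCrec : ∀ μ ℓ : ℕ, 1 ≤ μ → μ + 1 ≤ ℓ →
      C (μ + 1) ℓ = (-1 : ℂ) ^ (ℓ - 1) * (Nat.factorial (ℓ - 1)) *
        ∑ m ∈ Finset.Icc μ (ℓ - 1), (-1 : ℂ) ^ m * C μ m / (Nat.factorial m))
    (A : ℕ → ℕ → ℂ → ℂ)
    (hA : ∀ (μ ν : ℕ) (s : ℂ), A μ ν s =
      ∑ k ∈ Finset.range (ν - μ + 1),
        (∏ i ∈ Finset.range k, (-(μ : ℂ) - i)) / (Nat.factorial k) * C (μ + k) ν *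
          (2 * s - 1 + (θ : ℂ) * Complex.I) ^ k)
    (Q : ℕ → ℂ → ℂ)
    (hQ : ∀ (ν : ℕ) (s : ℂ), Q ν s = ∑ μ ∈ Finset.Icc 1 ν, V μ s * A μ ν s)
    (c : ℝ) (hc : 1 ≤ c) :
    ∃ c' : ℝ, 0 < c' ∧ ∀ s : ℂ, ∀ ν : ℕ, 1 ≤ ν → (ν : ℝ) ≤ ‖s‖ + c →
      ‖Q ν s‖ ≤ (c' * (‖s‖ + 1)) ^ (2 * ν) / (Nat.factorial ν) := by
  set S : ℝ := ∑ j, (lam j + ‖mu j‖) with hS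
  have hSj : ∀ j, lam j + ‖mu j‖ ≤ S := fun j =>
    Finset.single_le_sum (f := fun j => lam j + ‖mu j‖)
      (fun i _ => add_nonneg (hlam i).le (norm_nonneg _)) (Finset.mem_univ j)
  have hS0 : 0 ≤ S := Finset.sum_nonneg (fun i _ => add_nonneg (hlam i).le (norm_nonneg _))
  set L : ℝ := 1 + ∑ j, 1 / lam j with hL
  have hLs : 0 ≤ ∑ j, 1 / lam j := Finset.sum_nonneg (fun i _ => (one_div_pos.2 (hlam i)).le)
  have hLj : ∀ j, 1 / lam j ≤ L := fun j => by
    have := Finset.single_le_sum (f := fun j => 1 / lam j)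
      (fun i _ => (one_div_pos.2 (hlam i)).le) (Finset.mem_univ j)
    linarith
  have hθ0 := abs_nonneg θ
  set M : ℝ := 2 + |θ| + S with hM
  set K1 : ℝ := M + c + 1 with hK1
  set K : ℝ := (2 + 2 * r) * K1 * K1 * L with hKdef
  have hK1' : 1 ≤ K1 := by linarith
  have hL1 : 1 ≤ L := by linarith
  have hK : 1 ≤ K := by
    have h1 : (1:ℝ) ≤ 2 + 2 * r := by
      have : (0:ℝ) ≤ r := by positivity
      linarith
    exact one_le_mul_of_one_le_of_one_le (one_le_mul_of_one_le_of_one_le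
      (one_le_mul_of_one_le_of_one_le h1 hK1') hK1') hL1
  have hD : 1 ≤ 8 * c * K := by nlinarith
  refine ⟨4 * (8 * c * K + M + c), by linarith, ?_⟩
  intro s ν hν1 hν
  have hs0 := norm_nonneg s
  set T : ℝ := ‖s‖ + 1 with hT
  have hT1 : 1 ≤ T := by linarith
  have hνT : (ν:ℝ) ≤ c * T := by nlinarith
  have hθn : ‖(θ : ℂ) * Complex.I‖ = |θ| := by simp
  have hz : ‖2 * s - 1 + (θ : ℂ) * Complex.I‖ ≤ M * T := by
    have h1 : ‖2 * s - 1 + (θ : ℂ) * Complex.I‖ ≤ 2 * ‖s‖ + 1 + |θ| := by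
      refine norm_add_le_of_le (norm_sub_le_of_le ?_ ?_) hθn.le <;> simp
    nlinarith
  have hRb : ∀ n, 1 ≤ n → n ≤ ν → ‖R n s‖ ≤ T * (K * T) ^ n := by
    intro n hn1 hn2
    have hn3 : (n:ℝ) ≤ ν := by exact_mod_cast hn2
    have hfin : ∀ w : ℂ, ‖w‖ ≤ M * T → ((n + 1 : ℕ) : ℝ) + ‖w‖ ≤ K1 * T := by
      intro w hw
      push_cast
      rw [hK1]
      nlinarith
    rw [hR]
    apply aux_R r lam hlam _ _ _ _ K1 T L hK1' hT1 hL1 hLj n hn1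
    · apply hfin
      have h1 : ‖1 - 2 * s - (θ : ℂ) * Complex.I‖ ≤ 1 + 2 * ‖s‖ + |θ| := by
        refine norm_sub_le_of_le (norm_sub_le_of_le ?_ ?_) hθn.le <;> simp
      nlinarith
    · apply hfin
      rw [norm_one]; nlinarith
    · intro j
      apply hfin
      have hl := hlam j
      have h1 : ‖(lam j : ℂ) * (1 - s) + (starRingEnd ℂ) (mu j)‖
          ≤ lam j * (1 + ‖s‖) + ‖mu j‖ := by
        refine norm_add_le_of_le ?_ ?_
        · rw [norm_mul, Complex.norm_real, Real.norm_of_nonneg hl.le]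
          gcongr
          exact norm_sub_le_of_le (by simp) le_rfl
        · simp
      have h2 := hSj j
      have h3 := norm_nonneg (mu j)
      have h4 : lam j * (1 + ‖s‖) + ‖mu j‖ ≤ (lam j + ‖mu j‖) * T := by
        rw [hT]; nlinarith [mul_nonneg h3 hs0]
      have h5 : (lam j + ‖mu j‖) * T ≤ M * T := by gcongr; linarith
      linarith
    · intro j
      apply hfin
      have hl := hlam j
      have h1 : ‖1 - (lam j : ℂ) * s - mu j‖ ≤ 1 + lam j * ‖s‖ + ‖mu j‖ := by
        refine norm_sub_le_of_le (norm_sub_le_of_le (by simp) ?_) le_rfl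
        rw [norm_mul, Complex.norm_real, Real.norm_of_nonneg hl.le]
      have h2 := hSj j
      have h3 := norm_nonneg (mu j)
      have h4 : 1 + lam j * ‖s‖ + ‖mu j‖ ≤ (1 + (lam j + ‖mu j‖)) * T := by
        rw [hT]; nlinarith [mul_nonneg h3 hs0]
      have h5 : (1 + (lam j + ‖mu j‖)) * T ≤ M * T := by gcongr; linarith
      linarith
  have hVb : ∀ μ, 1 ≤ μ → μ ≤ ν → ‖V μ s‖ ≤ (8 * c * K * T ^ 2) ^ μ / μ.factorial := by
    intro μ h1 h2
    rw [hV μ s h1]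
    have h3 : (μ:ℝ) ≤ ν := by exact_mod_cast h2
    exact aux_V T K c hT1 hK hc μ h1 (h3.trans hνT) (fun n => R n s)
      (fun n ha hb => hRb n ha (hb.trans h2))
  rw [hQ]
  simp only [hA]
  exact aux_Q T (8 * c * K) M c hT1 hD (by linarith) hc ν hνT (fun μ => V μ s) _ hz hVb C
    (aux_C C hC1 hCrec)
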